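/- The logarithmic score arises from the mixture representation with mixing density proportional to (θ(1−θ))^{-1} over the elementary scores: for every x ∈ (0,1) and y ∈ {0,1}, ∫₀¹ S_θ(x,y) · (2θ(1−θ))^{-1} dθ = −y·log(x) − (1−y)·log(1−x). -/

import Mathlib

/-- The elementary scoring rule `S_θ(x,y)` for a probability forecast `x ∈ [0,1]`
and binary outcome `y ∈ {0,1}`. -/
noncomputable def elemScore (θ x y : ℝ) : ℝ :=
  2 * θ * (if θ < x ∧ y = 0 then 1 else 0)
    + 2 * (1 - θ) * (if x < θ ∧ y = 1 then 1 else 0)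
    + 2 * θ * (1 - θ) * (if x = θ then 1 else 0)

theorem aux_congr (a b : ℝ) (hab : a ≤ b) (f g : ℝ → ℝ)
    (hg : IntervalIntegrable g MeasureTheory.volume a b)
    (h : ∀ t, a < t → t < b → f t = g t) :
    IntervalIntegrable f MeasureTheory.volume a b ∧ ∫ t in a..b, f t = ∫ t in a..b, g t := by
  have hne : ∀ᵐ t : ℝ ∂MeasureTheory.volume, t ≠ b := by
    simp [MeasureTheory.ae_iff]
  have key : ∀ᵐ t : ℝ ∂MeasureTheory.volume, t ∈ Set.uIoc a b → f t = g t := by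
    filter_upwards [hne] with t ht hm
    rw [Set.uIoc_of_le hab] at hm
    exact h t hm.1 (lt_of_le_of_ne hm.2 ht)
  refine ⟨?_, intervalIntegral.integral_congr_ae key⟩
  refine hg.congr_ae ?_
  rw [Filter.EventuallyEq, MeasureTheory.ae_restrict_iff' measurableSet_uIoc]
  filter_upwards [key] with t ht hm
  exact (ht hm).symm

/-- The logarithmic score is the mixture of the elementary scores with mixing density
proportional to `(θ(1−θ))⁻¹`:
`∫₀¹ S_θ(x,y)·(2θ(1−θ))⁻¹ dθ = −y·log x − (1−y)·log(1−x)` for `x ∈ (0,1)` and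
`y ∈ {0,1}`. -/
theorem log_score_mixture_representation
    (x : ℝ) (hx : x ∈ Set.Ioo (0:ℝ) 1) (y : ℝ) (hy : y = 0 ∨ y = 1) :
    (∫ θ in (0:ℝ)..1, elemScore θ x y * (2 * θ * (1 - θ))⁻¹)
      = -(y * Real.log x) - (1 - y) * Real.log (1 - x) := by
  obtain ⟨h0, h1⟩ := hx
  have i1 : IntervalIntegrable (fun t : ℝ => (1 - t)⁻¹) MeasureTheory.volume 0 x := by
    apply ContinuousOn.intervalIntegrable
    rw [Set.uIcc_of_le h0.le]
    refine ContinuousOn.inv₀ (by fun_prop) ?_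
    intro t ht
    have := ht.2
    linarith
  have i2 : IntervalIntegrable (fun t : ℝ => t⁻¹) MeasureTheory.volume x 1 := by
    apply ContinuousOn.intervalIntegrable
    rw [Set.uIcc_of_le h1.le]
    refine ContinuousOn.inv₀ (by fun_prop) ?_
    intro t ht
    have := ht.1
    linarith
  have iz : ∀ a b : ℝ, IntervalIntegrable (fun _ : ℝ => (0:ℝ)) MeasureTheory.volume a b :=
    fun a b => intervalIntegrable_const
  rcases hy with rfl | rfl
  · obtain ⟨a1, a2⟩ := aux_congr 0 x h0.le
      (fun θ => elemScore θ x 0 * (2 * θ * (1 - θ))⁻¹) _ i1 (by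
        intro t ht ht'
        have e1 : t ≠ 0 := ht.ne'
        have e2 : 1 - t ≠ 0 := by linarith
        simp only [elemScore, ht', ht'.ne']
        norm_num
        field_simp)
    obtain ⟨b1, b2⟩ := aux_congr x 1 h1.le
      (fun θ => elemScore θ x 0 * (2 * θ * (1 - θ))⁻¹) _ (iz x 1) (by
        intro t ht ht'
        simp [elemScore, not_lt.mpr ht.le, ht.ne])
    rw [← intervalIntegral.integral_add_adjacent_intervals a1 b1, a2, b2,
      intervalIntegral.integral_comp_sub_left (fun t : ℝ => t⁻¹) 1,
      integral_inv_of_pos (by linarith) (by norm_num)]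
    simp
  · obtain ⟨a1, a2⟩ := aux_congr 0 x h0.le
      (fun θ => elemScore θ x 1 * (2 * θ * (1 - θ))⁻¹) _ (iz 0 x) (by
        intro t ht ht'
        simp [elemScore, not_lt.mpr ht'.le, ht'.ne'])
    obtain ⟨b1, b2⟩ := aux_congr x 1 h1.le
      (fun θ => elemScore θ x 1 * (2 * θ * (1 - θ))⁻¹) _ i2 (by
        intro t ht ht'
        have e1 : t ≠ 0 := by linarith
        have e2 : 1 - t ≠ 0 := by linarith
        simp only [elemScore, ht, ht.ne]
        norm_num
        field_simp)
    rw [← intervalIntegral.integral_add_adjacent_intervals a1 b1, a2, b2,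
      integral_inv_of_pos h0 (by norm_num)]
    simp
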